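/- arXiv:1912.00787 — 3 statements merged into one kernel-verified Lean document; each statement's English description precedes it below -/
import Mathlib

section
/- Suppose that the measure-preserving isometry group acts transitively on 𝒳, i.e. for all x, y ∈ 𝒳 there exists a bijective isometry i : 𝒳 → 𝒳 with i_*μ = μ and i(x) = y. Then the metric space (𝒳,d) is compact. -/
open MeasureTheory

/-- **Transitivity of the measure-preserving isometry group implies compactness.**
If `(𝒳,d)` is a complete separable metric space carrying a Borel probability measure `μ`
of full support, and if for all `x, y ∈ 𝒳` there is a bijective isometry `i : 𝒳 → 𝒳`
with `i_*μ = μ` and `i x = y`, then `𝒳` is compact. -/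
theorem stmt10
    {𝒳 : Type*} [MetricSpace 𝒳] [CompleteSpace 𝒳] [TopologicalSpace.SeparableSpace 𝒳]
    [MeasurableSpace 𝒳] [BorelSpace 𝒳]
    (μ : Measure 𝒳) [IsProbabilityMeasure μ] [μ.IsOpenPosMeasure]
    (htrans : ∀ x y : 𝒳, ∃ i : 𝒳 ≃ᵢ 𝒳, Measure.map i μ = μ ∧ i x = y) :
    CompactSpace 𝒳 := by
  have hball : ∀ (r : ℝ) (x y : 𝒳), μ (Metric.ball x r) = μ (Metric.ball y r) := by
    intro r x y
    obtain ⟨i, hi, hxy⟩ := htrans x y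
    have h : μ (Metric.ball y r) = Measure.map i μ (Metric.ball y r) := by rw [hi]
    rw [h, Measure.map_apply i.continuous.measurable Metric.isOpen_ball.measurableSet, ← hxy,
      i.isometry.preimage_ball]
  rw [← isCompact_univ_iff, isCompact_iff_totallyBounded_isComplete]
  refine ⟨?_, completeSpace_iff_isComplete_univ.mp inferInstance⟩
  rw [Metric.totallyBounded_iff]
  by_contra hcon
  push Not at hcon
  obtain ⟨ε, hε, hcov⟩ := hcon
  obtain ⟨f, -, hf⟩ := exists_seq_of_forall_finset_exists (fun _ : 𝒳 => True)
    (fun x y => ε ≤ dist x y) (by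
      intro s _
      have h := hcov (s : Set 𝒳) s.finite_toSet
      rw [Set.not_subset] at h
      obtain ⟨y, -, hy⟩ := h
      refine ⟨y, trivial, fun x hx => ?_⟩
      by_contra hlt
      apply hy
      rw [Set.mem_iUnion₂]
      refine ⟨x, hx, ?_⟩
      rw [Metric.mem_ball, dist_comm]
      exact not_le.mp hlt)
  have hsep : ∀ m n, m ≠ n → ε ≤ dist (f m) (f n) := by
    intro m n hmn
    rcases lt_or_gt_of_ne hmn with h | h
    · exact hf m n h
    · rw [dist_comm]; exact hf n m h
  have hfin := Measure.finite_const_le_meas_of_disjoint_iUnion μ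
    (ε := μ (Metric.ball (f 0) (ε / 2)))
    (Metric.measure_ball_pos μ (f 0) (by positivity))
    (As := fun n => Metric.ball (f n) (ε / 2))
    (fun n => Metric.isOpen_ball.measurableSet)
    (fun m n hmn => Metric.ball_disjoint_ball (by linarith [hsep m n hmn]))
    (measure_ne_top μ _)
  have huniv : {n : ℕ | μ (Metric.ball (f 0) (ε / 2)) ≤ μ (Metric.ball (f n) (ε / 2))}
      = Set.univ := by
    ext n
    simp [hball (ε / 2) (f 0) (f n)]
  rw [huniv] at hfin
  exact Set.infinite_univ hfin
end

section
/- Let 𝕋 = ℝ/ℤ be the circle endowed with the geodesic distance d(x̄,ȳ) = min_{k∈ℤ} |x − y − k| and with the probability Haar measure μ (the projection of the Lebesgue measure). Then for all x, y ∈ 𝕋, writing D = d(x,y): ∫_𝕋 d(w,x)·d(w,y) dμ(w) = (2/3)D³ − (1/2)D² + 1/12. -/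
open MeasureTheory

lemma norm_small (s : ℝ) (h1 : -(1/2) ≤ s) (h2 : s ≤ 1/2) : ‖(s : UnitAddCircle)‖ = |s| := by
  rw [AddCircle.norm_coe_eq_abs_iff (1:ℝ) one_ne_zero, abs_one]
  exact abs_le.2 ⟨h1, h2⟩

lemma norm_shift (s : ℝ) : ‖(s : UnitAddCircle)‖ = ‖((s + 1 : ℝ) : UnitAddCircle)‖ := by
  rw [AddCircle.coe_add_period]

lemma poly_int (a b p q r : ℝ) : ∫ w in a..b, (p * w ^ 2 + q * w + r) =
    p * (b ^ 3 - a ^ 3) / 3 + q * (b ^ 2 - a ^ 2) / 2 + r * (b - a) := by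
  have : ∀ w ∈ Set.uIcc a b, HasDerivAt (fun w : ℝ => p * w ^ 3 / 3 + q * w ^ 2 / 2 + r * w)
      (p * w ^ 2 + q * w + r) w := by
    intro w _
    have h1 := (((hasDerivAt_id w).pow 3).const_mul p).div_const 3
    have h2 := (((hasDerivAt_id w).pow 2).const_mul q).div_const 2
    have h3 := (hasDerivAt_id w).const_mul r
    refine ((h1.add h2).add h3).congr_deriv ?_
    simp
    ring
  rw [intervalIntegral.integral_eq_sub_of_hasDerivAt this
    (Continuous.intervalIntegrable (by fun_prop) _ _)]
  ring

lemma core (t : ℝ) (h0 : 0 ≤ t) (h1 : t ≤ 1/2) :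
    ∫ w : UnitAddCircle, ‖w‖ * ‖w - (t : UnitAddCircle)‖ =
      (2 / 3) * t ^ 3 - (1 / 2) * t ^ 2 + 1 / 12 := by
  rw [← UnitAddCircle.intervalIntegral_preimage (-(1/2))]
  set F : ℝ → ℝ := fun w => ‖(w : UnitAddCircle)‖ * ‖(w : UnitAddCircle) - (t : UnitAddCircle)‖
    with hF
  have hc : Continuous F := by
    have : Continuous (fun w : ℝ => (w : UnitAddCircle)) := AddCircle.continuous_mk' 1
    fun_prop
  have hi : ∀ a b, IntervalIntegrable F volume a b := fun a b => hc.intervalIntegrable a b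
  have e : ∀ w : ℝ, F w = ‖(w : UnitAddCircle)‖ * ‖((w - t : ℝ) : UnitAddCircle)‖ := fun w => by
    simp [hF]
  have key : ∀ a b p q r : ℝ, a ≤ b → (∀ w, a ≤ w → w ≤ b → F w = p * w ^ 2 + q * w + r) →
      ∫ w in a..b, F w =
        p * (b ^ 3 - a ^ 3) / 3 + q * (b ^ 2 - a ^ 2) / 2 + r * (b - a) := by
    intro a b p q r hab h
    rw [← poly_int]
    apply intervalIntegral.integral_congr
    intro w hw
    rw [Set.uIcc_of_le hab] at hw
    exact h w hw.1 hw.2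
  have k1 := key (-(1/2)) (t - 1/2) (-1) (t - 1) 0 (by linarith) (by
    intro w ha hb
    rw [e, norm_shift (w - t), norm_small w (by linarith) (by linarith),
      norm_small _ (by linarith) (by linarith), abs_of_nonpos (by linarith),
      abs_of_nonneg (by linarith)]
    ring)
  have k2 := key (t - 1/2) 0 1 (-t) 0 (by linarith) (by
    intro w ha hb
    rw [e, norm_small w (by linarith) (by linarith),
      norm_small _ (by linarith) (by linarith), abs_of_nonpos (by linarith),
      abs_of_nonpos (by linarith)]
    ring)
  have k3 := key 0 t (-1) t 0 (by linarith) (by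
    intro w ha hb
    rw [e, norm_small w (by linarith) (by linarith),
      norm_small _ (by linarith) (by linarith), abs_of_nonneg (by linarith),
      abs_of_nonpos (by linarith)]
    ring)
  have k4 := key t (1/2) 1 (-t) 0 (by linarith) (by
    intro w ha hb
    rw [e, norm_small w (by linarith) (by linarith),
      norm_small _ (by linarith) (by linarith), abs_of_nonneg (by linarith),
      abs_of_nonneg (by linarith)]
    ring)
  change ∫ w in (-(1/2))..(-(1/2) + 1), F w = _
  rw [show (-(1/2) + 1 : ℝ) = 1/2 by norm_num,
    ← intervalIntegral.integral_add_adjacent_intervals (hi _ (t - 1/2)) (hi _ _),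
    ← intervalIntegral.integral_add_adjacent_intervals (hi (t - 1/2) 0) (hi _ _),
    ← intervalIntegral.integral_add_adjacent_intervals (hi 0 t) (hi _ _), k1, k2, k3, k4]
  ring

lemma half (x y : UnitAddCircle) (t : ℝ) (h0 : 0 ≤ t) (h1 : t ≤ 1/2) (h : y - x = t) :
    ∫ w : UnitAddCircle, dist w x * dist w y =
      (2 / 3) * dist x y ^ 3 - (1 / 2) * dist x y ^ 2 + 1 / 12 := by
  have hd : dist x y = t := by
    rw [dist_comm, dist_eq_norm, h, norm_small t (by linarith) h1, abs_of_nonneg h0]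
  rw [hd, ← core t h0 h1, ← integral_add_right_eq_self _ x]
  congr 1
  ext w
  rw [dist_eq_norm, dist_eq_norm, ← h]
  congr 2 <;> abel

/-- **Second-order distance integral on the circle:** on `𝕋 = ℝ/ℤ` with its geodesic
distance and its Haar probability measure (the volume), for all `x, y ∈ 𝕋`, writing
`D = d(x,y)`, one has `∫ d(w,x) d(w,y) dw = (2/3)D³ - (1/2)D² + 1/12`. -/
theorem stmt17 (x y : UnitAddCircle) :
    ∫ w : UnitAddCircle, dist w x * dist w y =
      (2 / 3) * dist x y ^ 3 - (1 / 2) * dist x y ^ 2 + 1 / 12 := by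
  obtain ⟨s, hs⟩ := QuotientAddGroup.mk_surjective (y - x)
  have hs' : y - x = ((s - round s : ℝ) : UnitAddCircle) := by
    rw [← hs]
    have : ((round s : ℝ) : UnitAddCircle) = 0 := by
      rw [AddCircle.coe_eq_zero_iff]
      exact ⟨round s, by simp⟩
    rw [AddCircle.coe_sub, this, sub_zero]
  have hb := abs_le.1 (abs_sub_round s)
  rcases le_total 0 (s - round s) with h | h
  · exact half x y _ h hb.2 hs'
  · have := half y x (-(s - round s)) (by linarith) (by linarith) (by
      rw [AddCircle.coe_neg, ← hs', neg_sub])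
    rw [dist_comm x y, ← this]
    simp only [mul_comm]
end

section
/- Let 𝕋 = ℝ/ℤ be the circle endowed with the geodesic distance d(x̄,ȳ) = min_{k∈ℤ} |x − y − k| and with the probability Haar measure μ. Then for all x, y, z ∈ 𝕋: ∫_𝕋 (1/4 − d(w,x))·(1/4 − d(w,y))·(1/4 − d(w,z)) dμ(w) = 0. -/
open MeasureTheory

lemma norm_add_half_aux (u : UnitAddCircle) :
    ‖u + ((1 / 2 : ℝ) : UnitAddCircle)‖ = 1 / 2 - ‖u‖ := by
  have key : ∀ s : ℝ, |s| ≤ 1 / 2 → ‖(s : UnitAddCircle)‖ = |s| := fun s hs =>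
    (AddCircle.norm_coe_eq_abs_iff (p := (1 : ℝ)) one_ne_zero).2 (by simpa using hs)
  obtain ⟨t, rfl⟩ := QuotientAddGroup.mk_surjective u
  have h1 : ((t : ℝ) : UnitAddCircle) = ((t - round t : ℝ) : UnitAddCircle) := by
    rw [eq_comm, ← sub_eq_zero, ← AddCircle.coe_sub, AddCircle.coe_eq_zero_iff]
    exact ⟨-round t, by simp⟩
  change ‖(t : UnitAddCircle) + _‖ = 1 / 2 - ‖(t : UnitAddCircle)‖
  rw [h1]
  have hs := abs_sub_round t
  generalize t - (round t : ℝ) = s at hs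
  rw [key s hs]
  have hs' := abs_le.1 hs
  rcases le_total 0 s with h | h
  · have h2 : (s : UnitAddCircle) + ((1 / 2 : ℝ) : UnitAddCircle)
        = ((s - 1 / 2 : ℝ) : UnitAddCircle) := by
      rw [← AddCircle.coe_add, ← sub_eq_zero, ← AddCircle.coe_sub, AddCircle.coe_eq_zero_iff]
      exact ⟨1, by norm_num⟩
    have h3 : |s - 1 / 2| = 1 / 2 - s := by
      rw [abs_of_nonpos (by linarith)]; ring
    rw [h2, key _ (by rw [h3]; linarith), h3, abs_of_nonneg h]
  · have h3 : |s + 1 / 2| = s + 1 / 2 := abs_of_nonneg (by linarith)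
    rw [← AddCircle.coe_add, key _ (by rw [h3]; linarith), h3, abs_of_nonpos h]
    ring

/-- **Third-order centered distance integral on the circle:** on `𝕋 = ℝ/ℤ` with its
geodesic distance and its Haar probability measure, for all `x, y, z ∈ 𝕋`,
`∫ (1/4 - d(w,x))(1/4 - d(w,y))(1/4 - d(w,z)) dw = 0`. -/
theorem stmt18 (x y z : UnitAddCircle) :
    ∫ w : UnitAddCircle,
      (1 / 4 - dist w x) * (1 / 4 - dist w y) * (1 / 4 - dist w z) = 0 := by
  have h := integral_add_right_eq_self (μ := (volume : Measure UnitAddCircle))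
    (fun w : UnitAddCircle =>
      (1 / 4 - dist w x) * (1 / 4 - dist w y) * (1 / 4 - dist w z))
    ((1 / 2 : ℝ) : UnitAddCircle)
  have hd : ∀ w v : UnitAddCircle,
      dist (w + ((1 / 2 : ℝ) : UnitAddCircle)) v = 1 / 2 - dist w v := by
    intro w v
    rw [dist_eq_norm, dist_eq_norm, ← norm_add_half_aux, sub_add_eq_add_sub]
  have h2 : ∀ w : UnitAddCircle,
      (1 / 4 - (1 / 2 - dist w x)) * (1 / 4 - (1 / 2 - dist w y)) * (1 / 4 - (1 / 2 - dist w z))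
      = -((1 / 4 - dist w x) * (1 / 4 - dist w y) * (1 / 4 - dist w z)) := by
    intro w; ring
  simp only [hd, h2] at h
  rw [integral_neg] at h
  linarith
end
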